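/- arXiv:1507.00190 — 2 statements merged into one kernel-verified Lean document; each statement's English description precedes it below -/
import Mathlib

section
/- For each primitive fifth root of unity ζ, the lines L_i and L_{i+6} of 𝒜^ζ intersect in exactly one point Q_i for i = 1,2,3,4, and the four points Q₁, Q₂, Q₃, Q₄ all lie on the line L₁₁. -/
open scoped LinearAlgebra.Projectivization
open Projectivization

abbrev P2 : Type := ℙ ℂ (Fin 3 → ℂ)

noncomputable instance : TopologicalSpace P2 :=
  inferInstanceAs (TopologicalSpace (Quotient (projectivizationSetoid ℂ (Fin 3 → ℂ))))

/-- The projective line `{[x:y:z] | v₀x + v₁y + v₂z = 0}` in `ℙ²(ℂ)`. -/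
def lineOf (v : Fin 3 → ℂ) : Set P2 :=
  {p | v 0 * p.rep 0 + v 1 * p.rep 1 + v 2 * p.rep 2 = 0}

/-- Coefficient vectors of the twelve lines of `𝒜^ζ`
(index `i : Fin 12` corresponds to the line `L_{i+1}`), with `ζ̄ = ζ⁻¹`. -/
noncomputable def coeffs (ζ : ℂ) : Fin 12 → Fin 3 → ℂ :=
  ![![1, 0, -1], ![1, 1, 0], ![1, 0, 1], ![1, -1, 0], ![0, 1, -1], ![0, 1, 1],
    ![1, -(ζ⁻¹ ^ 2 + ζ⁻¹), -(ζ ^ 2 + ζ)],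
    ![1, ζ⁻¹ + ζ ^ 2, -(ζ⁻¹ ^ 2 + ζ)],
    ![1, ζ ^ 2 + ζ, ζ⁻¹ ^ 2 + ζ⁻¹],
    ![1, -(ζ⁻¹ ^ 2 + ζ), ζ⁻¹ + ζ ^ 2],
    ![5, 1 + 2 * ζ + 3 * ζ ^ 2 - ζ⁻¹ ^ 2, -(2 + 4 * ζ + ζ ^ 2 + 3 * ζ⁻¹ ^ 2)],
    ![1, -(1 + ζ⁻¹), ζ⁻¹]]

/-- The line `L_{i+1}` of the arrangement `𝒜^ζ`. -/
noncomputable def lineA (ζ : ℂ) (i : Fin 12) : Set P2 := lineOf (coeffs ζ i)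

/-- The union of the twelve lines of the arrangement `𝒜^ζ`. -/
noncomputable def unionA (ζ : ℂ) : Set P2 := ⋃ i, lineA ζ i

open Matrix in
lemma mem_lineOf_iff (v : Fin 3 → ℂ) (p : P2) : p ∈ lineOf v ↔ v ⬝ᵥ p.rep = 0 := by
  simp [lineOf, dotProduct, Fin.sum_univ_three]

open Matrix in
lemma mk_mem_lineOf_iff (v w : Fin 3 → ℂ) (hw : w ≠ 0) :
    mk ℂ w hw ∈ lineOf v ↔ v ⬝ᵥ w = 0 := by
  obtain ⟨a, ha⟩ := exists_smul_eq_mk_rep ℂ w hw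
  rw [mem_lineOf_iff, ← ha, Units.smul_def, dotProduct_smul, smul_eq_mul, mul_eq_zero,
    or_iff_right a.ne_zero]

open Matrix in
/-- Two lines with linearly independent coefficient vectors meet exactly in the point given by
the cross product of these vectors. -/
lemma lineOf_inter_lineOf (v w : Fin 3 → ℂ) (h : crossProduct v w ≠ 0) :
    lineOf v ∩ lineOf w = {mk ℂ (crossProduct v w) h} := by
  ext p
  induction p using Projectivization.ind with | h r hr =>
  rw [Set.mem_inter_iff, Set.mem_singleton_iff, mk_mem_lineOf_iff, mk_mem_lineOf_iff]
  constructor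
  · rintro ⟨hv, hw⟩
    rw [mk_eq_mk_iff_crossProduct_eq_zero, cross_cross_eq_smul_sub_smul', dotProduct_comm r w,
      hv, hw, zero_smul, zero_smul, sub_zero]
  · rw [← mk_mem_lineOf_iff v r hr, ← mk_mem_lineOf_iff w r hr]
    intro hp
    rw [hp, mk_mem_lineOf_iff, mk_mem_lineOf_iff]
    exact ⟨dot_self_cross v w, dot_cross_self v w⟩

open Matrix in
lemma exists_lineOf_inter_eq_singleton (u v w : Fin 3 → ℂ) (h : crossProduct v w ≠ 0)
    (hu : u ⬝ᵥ crossProduct v w = 0) :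
    ∃ q : P2, lineOf v ∩ lineOf w = {q} ∧ q ∈ lineOf u :=
  ⟨_, lineOf_inter_lineOf v w h, (mk_mem_lineOf_iff u _ h).2 hu⟩

/-- For each primitive fifth root of unity `ζ` and each `i = 1,2,3,4`, the lines `L_i` and
`L_{i+6}` of `𝒜^ζ` meet in exactly one point `Q_i`, and `Q_i` lies on `L₁₁`. -/
theorem statement7 (ζ : ℂ) (h : IsPrimitiveRoot ζ 5) (i : Fin 4) :
    ∃ q : P2,
      lineA ζ ⟨i.val, by have := i.isLt; omega⟩ ∩
        lineA ζ ⟨i.val + 6, by have := i.isLt; omega⟩ = {q} ∧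
      q ∈ lineA ζ 10 := by
  have hsum : 1 + ζ + ζ ^ 2 + ζ ^ 3 + ζ ^ 4 = 0 := by
    simpa [Finset.sum_range_succ] using h.geom_sum_eq_zero (by norm_num)
  have hinv : ζ⁻¹ = ζ ^ 4 :=
    inv_eq_of_mul_eq_one_right (by linear_combination h.pow_eq_one)
  apply exists_lineOf_inter_eq_singleton
  · intro hc
    have hc₀ := congrFun hc 0
    fin_cases i <;> simp [cross_apply, coeffs, hinv] at hc₀ <;> grind
  · fin_cases i <;> simp [cross_apply, coeffs, hinv, dotProduct, Fin.sum_univ_three] <;> grind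
end

section
/- The four eleven-line arrangements (𝒜')^ζ, as ζ ranges over the primitive fifth roots of unity, are pairwise projectively equivalent: for any two primitive fifth roots of unity ζ, ζ′ there exists a projective linear automorphism of ℙ²(ℂ) mapping the line L_j of (𝒜')^ζ onto the line L_{τ(j)} of (𝒜')^{ζ′} for all j ∈ {1,…,11}, where τ is some power of the permutation σ = (1 2 3 4)(7 8 9 10)(5 6) of {1,…,11} fixing 11. -/
open scoped LinearAlgebra.Projectivization
open Projectivization

/-- Coefficient vectors of the eleven lines of `(𝒜')^ζ`
(index `i : Fin 11` corresponds to the line `L_{i+1}`), with `ζ̄ = ζ⁻¹`. -/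
noncomputable def coeffs11 (ζ : ℂ) : Fin 11 → Fin 3 → ℂ :=
  ![![1, 0, -1], ![1, 1, 0], ![1, 0, 1], ![1, -1, 0], ![0, 1, -1], ![0, 1, 1],
    ![1, -(ζ⁻¹ ^ 2 + ζ⁻¹), -(ζ ^ 2 + ζ)],
    ![1, ζ⁻¹ + ζ ^ 2, -(ζ⁻¹ ^ 2 + ζ)],
    ![1, ζ ^ 2 + ζ, ζ⁻¹ ^ 2 + ζ⁻¹],
    ![1, -(ζ⁻¹ ^ 2 + ζ), ζ⁻¹ + ζ ^ 2],
    ![5, 1 + 2 * ζ + 3 * ζ ^ 2 - ζ⁻¹ ^ 2, -(2 + 4 * ζ + ζ ^ 2 + 3 * ζ⁻¹ ^ 2)]]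

/-- The line `L_{i+1}` of the arrangement `(𝒜')^ζ`. -/
noncomputable def lineA' (ζ : ℂ) (i : Fin 11) : Set P2 := lineOf (coeffs11 ζ i)

/-- The permutation `σ = (1 2 3 4)(7 8 9 10)(5 6)` of the eleven lines (0-indexed:
`(0 1 2 3)(6 7 8 9)(4 5)`, fixing `10`). -/
def sigmaPerm : Equiv.Perm (Fin 11) where
  toFun := ![1, 2, 3, 0, 5, 4, 7, 8, 9, 6, 10]
  invFun := ![3, 0, 1, 2, 5, 4, 9, 6, 7, 8, 10]
  left_inv := by decide
  right_inv := by decide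

theorem mk_mem_lineOf_iff_s9 (c v : Fin 3 → ℂ) (hv : v ≠ 0) :
    Projectivization.mk ℂ v hv ∈ lineOf c ↔ c 0 * v 0 + c 1 * v 1 + c 2 * v 2 = 0 := by
  obtain ⟨a, ha⟩ := Projectivization.exists_smul_eq_mk_rep ℂ v hv
  have key : c 0 * (a • v) 0 + c 1 * (a • v) 1 + c 2 * (a • v) 2 =
      (a : ℂ) * (c 0 * v 0 + c 1 * v 1 + c 2 * v 2) := by
    simp only [Pi.smul_apply, Units.smul_def, smul_eq_mul]
    ring
  rw [lineOf, Set.mem_ofPred_eq, ← ha, key]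
  simp

/-- A linear automorphism compatible with two coefficient vectors maps the line of the first
onto the line of the second. -/
theorem map_image_lineOf (f : (Fin 3 → ℂ) ≃ₗ[ℂ] (Fin 3 → ℂ)) (c d : Fin 3 → ℂ)
    (hcd : ∀ v, d 0 * f v 0 + d 1 * f v 1 + d 2 * f v 2 = c 0 * v 0 + c 1 * v 1 + c 2 * v 2) :
    Projectivization.map f.toLinearMap f.injective '' lineOf c = lineOf d := by
  ext p
  constructor
  · rintro ⟨q, hq, rfl⟩
    induction q using Projectivization.ind with
    | h v hv =>
      rw [mk_mem_lineOf_iff_s9] at hq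
      rw [Projectivization.map_mk, mk_mem_lineOf_iff_s9]
      exact (hcd v).trans hq
  · intro hp
    induction p using Projectivization.ind with
    | h w hw =>
      obtain ⟨v, rfl⟩ := f.surjective w
      have hv : v ≠ 0 := by
        rintro rfl
        exact hw (map_zero f)
      refine ⟨Projectivization.mk ℂ v hv, ?_, Projectivization.map_mk _ _ _ _⟩
      rw [mk_mem_lineOf_iff_s9] at hp ⊢
      exact (hcd v).symm.trans hp

/-- The quarter turn `(x, y, z) ↦ (x, -z, y)`. -/
def quarterTurn : (Fin 3 → ℂ) ≃ₗ[ℂ] (Fin 3 → ℂ) where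
  toFun v := ![v 0, -v 2, v 1]
  invFun v := ![v 0, v 2, -v 1]
  map_add' v w := by
    ext i
    fin_cases i <;> simp [add_comm]
  map_smul' a v := by
    ext i
    fin_cases i <;> simp
  left_inv v := by
    ext i
    fin_cases i <;> simp
  right_inv v := by
    ext i
    fin_cases i <;> simp

theorem quarterTurn_apply (v : Fin 3 → ℂ) : quarterTurn v = ![v 0, -v 2, v 1] := rfl

theorem coeffs11_pow_three {ζ : ℂ} (h : IsPrimitiveRoot ζ 5) (j : Fin 11) :
    coeffs11 (ζ ^ 3) (sigmaPerm j) = quarterTurn (coeffs11 ζ j) ∨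
      coeffs11 (ζ ^ 3) (sigmaPerm j) = -quarterTurn (coeffs11 ζ j) := by
  have h5 : ζ ^ 5 = 1 := h.pow_eq_one
  have hsum : 1 + ζ + ζ ^ 2 + ζ ^ 3 + ζ ^ 4 = 0 := by
    simpa [Finset.sum_range_succ] using h.geom_sum_eq_zero (by norm_num)
  have hinv : ζ⁻¹ = ζ ^ 4 := inv_eq_of_mul_eq_one_left (by linear_combination h5)
  have hinv3 : (ζ ^ 3)⁻¹ = ζ ^ 2 := inv_eq_of_mul_eq_one_left (by linear_combination h5)
  fin_cases j <;> [left; left; left; left; left; right; left; left; left; left; left] <;>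
    ext i <;> fin_cases i <;>
    simp [coeffs11, sigmaPerm, quarterTurn_apply, hinv, hinv3] <;> grind

theorem quarterTurn_image_lineA' {ζ : ℂ} (h : IsPrimitiveRoot ζ 5) (j : Fin 11) :
    Projectivization.map quarterTurn.toLinearMap quarterTurn.injective '' lineA' ζ j =
      lineA' (ζ ^ 3) (sigmaPerm j) := by
  have lineOf_neg (c : Fin 3 → ℂ) : lineOf (-c) = lineOf c := by
    ext p
    simp only [lineOf, Set.mem_ofPred_eq, Pi.neg_apply, neg_mul, ← neg_add, neg_eq_zero]
  have himage (c : Fin 3 → ℂ) :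
      Projectivization.map quarterTurn.toLinearMap quarterTurn.injective '' lineOf c =
        lineOf (quarterTurn c) := by
    refine map_image_lineOf quarterTurn _ _ fun v => ?_
    simp [quarterTurn_apply]
    ring
  rw [lineA', lineA', himage]
  rcases coeffs11_pow_three h j with hj | hj
  · rw [hj]
  · rw [hj, lineOf_neg]

theorem exists_map_image_lineA'_pow {ζ : ℂ} (h : IsPrimitiveRoot ζ 5) (k : ℕ) :
    ∃ f : (Fin 3 → ℂ) ≃ₗ[ℂ] (Fin 3 → ℂ), ∀ j : Fin 11,
      Projectivization.map f.toLinearMap f.injective '' lineA' ζ j =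
        lineA' (ζ ^ 3 ^ k) ((sigmaPerm ^ k) j) := by
  induction k with
  | zero =>
    refine ⟨LinearEquiv.refl ℂ _, fun j => ?_⟩
    simp
  | succ k ih =>
    obtain ⟨f, hf⟩ := ih
    refine ⟨f.trans quarterTurn, fun j => ?_⟩
    have hk : IsPrimitiveRoot (ζ ^ 3 ^ k) 5 :=
      h.pow_of_coprime _ (Nat.Coprime.pow_left k (by norm_num))
    have hcomp := Projectivization.map_comp f.toLinearMap f.injective
      quarterTurn.toLinearMap quarterTurn.injective
    rw [pow_succ 3, pow_mul, pow_succ' sigmaPerm, Equiv.Perm.mul_apply,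
      ← quarterTurn_image_lineA' hk, ← hf, ← Set.image_comp]
    exact congrArg (fun g => g '' lineA' ζ j) hcomp

/-- The four arrangements `(𝒜')^ζ` are pairwise projectively equivalent: some projective
linear automorphism of `ℙ²(ℂ)` maps `L_j` of `(𝒜')^ζ` onto `L_{τ(j)}` of `(𝒜')^{ζ′}`
where `τ` is some power of `σ = (1 2 3 4)(7 8 9 10)(5 6)`. -/
theorem statement9 (ζ ζ' : ℂ) (h : IsPrimitiveRoot ζ 5) (h' : IsPrimitiveRoot ζ' 5) :
    ∃ (f : (Fin 3 → ℂ) ≃ₗ[ℂ] (Fin 3 → ℂ)) (k : ℕ),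
      ∀ j : Fin 11,
        Projectivization.map f.toLinearMap f.injective '' lineA' ζ j =
          lineA' ζ' ((sigmaPerm ^ k) j) := by
  obtain ⟨i, hi, hcop, rfl⟩ := h.isPrimitiveRoot_iff.1 h'
  have hmod : ∃ k : ℕ, ζ ^ 3 ^ k = ζ ^ i := by
    have hexp : ∃ k : ℕ, 3 ^ k % 5 = i % 5 := by
      interval_cases i
      · simp at hcop
      · exact ⟨0, rfl⟩
      · exact ⟨3, rfl⟩
      · exact ⟨1, rfl⟩
      · exact ⟨2, rfl⟩
    obtain ⟨k, hk⟩ := hexp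
    exact ⟨k, by rw [pow_eq_pow_mod _ h.pow_eq_one, hk, ← pow_eq_pow_mod _ h.pow_eq_one]⟩
  obtain ⟨k, hk⟩ := hmod
  obtain ⟨f, hf⟩ := exists_map_image_lineA'_pow h k
  exact ⟨f, k, fun j => hk ▸ hf j⟩
end
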